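/- Let G be a connected graph that is not a complete graph of odd order. Then the codegree of its matching polytope M_G equals Δ(G) + 1. -/

import Mathlib

open Finset

noncomputable section

/-- The dilation `kP` of a set `P ⊆ ℝ^ι`. -/
def dilate {ι : Type*} (k : ℕ) (P : Set (ι → ℝ)) : Set (ι → ℝ) :=
  (fun x => (k : ℝ) • x) '' P

/-- A point of `ℝ^ι` is a lattice point if all its coordinates are integers. -/
def IsLatticePt {ι : Type*} (x : ι → ℝ) : Prop := ∀ i, ∃ m : ℤ, x i = m

/-- The codegree of a (full-dimensional lattice) polytope `P ⊆ ℝ^ι`: the smallest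
positive integer `k` such that the interior of `kP` contains a lattice point. -/
def codeg {ι : Type*} (P : Set (ι → ℝ)) : ℕ :=
  sInf {k | 0 < k ∧ ∃ x, IsLatticePt x ∧ x ∈ interior (dilate k P)}

/-- The stable set polytope of a simple graph: the convex hull of the indicator
vectors of the stable (independent) sets of `G`. -/
def stablePolytope {V : Type*} (G : SimpleGraph V) : Set (V → ℝ) :=
  convexHull ℝ {x | ∃ S : Set V, (∀ u ∈ S, ∀ v ∈ S, ¬ G.Adj u v) ∧
    x = S.indicator (fun _ => (1 : ℝ))}

/-- The matching polytope of `G`: the convex hull in `ℝ^{E(G)}` of the indicator vectors of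
the matchings (sets of pairwise disjoint edges) of `G`. -/
def matchingPolytope {V : Type*} (G : SimpleGraph V) : Set (G.edgeSet → ℝ) :=
  convexHull ℝ {x | ∃ M : Set (Sym2 V), M ⊆ G.edgeSet ∧
    (∀ e ∈ M, ∀ f ∈ M, e ≠ f → ∀ v : V, ¬(v ∈ e ∧ v ∈ f)) ∧
    x = Set.indicator {e : G.edgeSet | (e : Sym2 V) ∈ M} (fun _ => (1 : ℝ))}

open Classical in
/-- Two involutions on a connected alternating component: at most two fixed points in total. -/
lemma alt_component {V : Type*} [Fintype V] (f g : V → V) (hf : Function.Involutive f)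
    (hg : Function.Involutive g) (t : V) : ∃ K : Finset V, t ∈ K ∧
    (∀ a, f a ∈ K ↔ a ∈ K) ∧ (∀ a, g a ∈ K ↔ a ∈ K) ∧
    (∀ C : Set V, t ∈ C → (∀ a ∈ C, f a ∈ C ∧ g a ∈ C) → ∀ a ∈ K, a ∈ C) ∧
    (K.filter (fun a => f a = a)).card + (K.filter (fun a => g a = a)).card ≤ 2 := by
  let H : SimpleGraph V := SimpleGraph.fromRel (fun a b => b = f a ∨ b = g a)
  have hadj : ∀ a b, H.Adj a b → (b = f a ∨ b = g a) := by
    intro a b h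
    rw [SimpleGraph.fromRel_adj] at h
    obtain ⟨_, h | h⟩ := h
    · exact h
    · rcases h with h | h
      · left; rw [h, hf]
      · right; rw [h, hg]
  have hstepf : ∀ a, H.Reachable a (f a) := by
    intro a
    by_cases h : f a = a
    · rw [h]
    · exact SimpleGraph.Adj.reachable (by rw [SimpleGraph.fromRel_adj]; exact ⟨fun h' => h h'.symm, by tauto⟩)
  have hstepg : ∀ a, H.Reachable a (g a) := by
    intro a
    by_cases h : g a = a
    · rw [h]
    · exact SimpleGraph.Adj.reachable (by rw [SimpleGraph.fromRel_adj]; exact ⟨fun h' => h h'.symm, by tauto⟩)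
  let c := H.connectedComponentMk t
  have hc : ∀ a, a ∈ c.supp ↔ H.Reachable a t := by
    intro a
    rw [SimpleGraph.ConnectedComponent.mem_supp_iff]
    exact SimpleGraph.ConnectedComponent.eq
  refine ⟨univ.filter (fun a => a ∈ c.supp), ?_, ?_, ?_, ?_, ?_⟩
  · simp [hc]
  · intro a
    simp only [mem_filter, mem_univ, true_and, hc]
    exact ⟨fun h => (hstepf a).trans h, fun h => (hstepf a).symm.trans h⟩
  · intro a
    simp only [mem_filter, mem_univ, true_and, hc]
    exact ⟨fun h => (hstepg a).trans h, fun h => (hstepg a).symm.trans h⟩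
  · intro C ht hC a ha
    simp only [mem_filter, mem_univ, true_and, hc] at ha
    obtain ⟨p⟩ := ha.symm
    clear ha
    have : ∀ x y, H.Walk x y → x ∈ C → y ∈ C := by
      intro x y p
      induction p with
      | nil => exact id
      | cons h p ih =>
        intro hx
        apply ih
        rcases hadj _ _ h with h | h
        · rw [h]; exact (hC _ hx).1
        · rw [h]; exact (hC _ hx).2
    exact this _ _ p ht
  · let Hc : SimpleGraph c.supp := H.induce c.supp
    have hconn : Hc.Connected := c.connected_toSimpleGraph
    have h1 := hconn.card_vert_le_card_edgeSet_add_one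
    have h2 := Hc.sum_degrees_eq_twice_card_edges
    have h3 : ∀ v : c.supp, Hc.degree v + ((if f v = v then 1 else 0) + (if g v = v then 1 else 0)) ≤ 2 := by
      intro v
      have : Hc.degree v ≤ (({f v, g v} : Finset V).erase v).card := by
        rw [← SimpleGraph.card_neighborFinset_eq_degree]
        apply Finset.card_le_card_of_injOn (fun x => x.1)
        · intro x hx
          have hx' : Hc.Adj v x := by simpa using hx
          have hx'' : H.Adj v x := hx'
          have := hadj _ _ hx''
          have hne := hx''.ne
          simp only [coe_erase, coe_insert, coe_singleton, Set.mem_sdiff, Set.mem_insert_iff, Set.mem_singleton_iff]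
          exact ⟨this, fun h => hne h.symm⟩
        · intro x _ y _ h
          exact Subtype.ext h
      have h4 : (({f v, g v} : Finset V).erase v).card + ((if f v = v then 1 else 0) + (if g v = v then 1 else 0)) ≤ 2 := by
        by_cases hfv : f v = v <;> by_cases hgv : g v = v
        · simp [hfv, hgv]
        · have : (({f v, g v} : Finset V).erase v) ⊆ {g v} := by
            intro x; simp [hfv]
          have := card_le_card this
          simp [hfv, hgv] at this ⊢; omega
        · have : (({f v, g v} : Finset V).erase v) ⊆ {f v} := by
            intro x; simp [hgv]; tauto
          have := card_le_card this
          simp [hfv, hgv] at this ⊢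
        · have := card_le_card (erase_subset (v:V) ({f v, g v} : Finset V))
          have := card_le_two (a := f v) (b := g v)
          simp only [hfv, hgv, if_false]; omega
      omega
    have h4 := Finset.sum_le_sum (fun v (_ : v ∈ (univ : Finset c.supp)) => h3 v)
    rw [sum_add_distrib, h2, sum_add_distrib] at h4
    have h5 : ∀ (k : V → V), ∑ v : c.supp, (if k v = v then 1 else 0) =
        ((univ.filter (fun a => a ∈ c.supp)).filter (fun a => k a = a)).card := by
      intro k
      rw [card_filter]
      exact (Finset.sum_subtype (univ.filter (fun a => a ∈ c.supp)) (by simp) (fun a => if k a = a then 1 else 0)).symm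
    rw [h5, h5] at h4
    simp only [sum_const, card_univ, smul_eq_mul] at h4
    rw [Nat.card_eq_fintype_card, Nat.card_eq_fintype_card, ← SimpleGraph.edgeFinset_card] at h1
    omega

/-- parity -/
lemma even_weight {V : Type*} [Fintype V] (f : V → V) (hf : Function.Involutive f)
    (w : V → V → ℕ) (hs : ∀ a b, w a b = w b a) (h0 : ∀ a, w a a = 0) :
    Even (∑ v, w v (f v)) := by
  have : ((∑ v, w v (f v) : ℕ) : ZMod 2) = 0 := by
    push_cast
    apply Finset.sum_involution (fun a _ => f a)
    · intro a _
      rw [hf, hs (f a) a, ← two_mul]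
      have : (2 : ZMod 2) = 0 := rfl
      rw [this, zero_mul]
    · intro a _ h h'
      rw [h', h0] at h
      simp at h
    · intro a _; exact mem_univ _
    · intro a _; exact hf a
  rw [ZMod.natCast_eq_zero_iff] at this
  exact even_iff_two_dvd.mpr this

/-- An involution all of whose moved pairs have positive weight. -/
def GoodInv {V : Type*} (w : V → V → ℕ) (f : V → V) : Prop :=
  Function.Involutive f ∧ ∀ v, f v ≠ v → 0 < w v (f v)

open Classical in
lemma good_normalize {V : Type*} [Fintype V] (w : V → V → ℕ) (hs : ∀ a b, w a b = w b a)
    (h0 : ∀ a, w a a = 0) (f : V → V) (hf : Function.Involutive f) :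
    ∃ g, GoodInv w g ∧ ∑ v, w v (g v) = ∑ v, w v (f v) := by
  refine ⟨fun v => if w v (f v) = 0 then v else f v, ⟨?_, ?_⟩, ?_⟩
  · intro v
    by_cases h : w v (f v) = 0
    · simp [h]
    · have : w (f v) v ≠ 0 := by rw [hs]; exact h
      simp [h, hf v, this]
  · intro v h
    by_cases h' : w v (f v) = 0
    · simp [h'] at h
    · simp only [h', if_false]; omega
  · apply sum_congr rfl
    intro v _
    by_cases h' : w v (f v) = 0
    · simp [h', h0]
    · simp [h']

lemma good_mono {V : Type*} (w w' : V → V → ℕ) (h : ∀ a b, w' a b ≤ w a b) (f : V → V)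
    (hf : GoodInv w' f) : GoodInv w f :=
  ⟨hf.1, fun v hv => lt_of_lt_of_le (hf.2 v hv) (h _ _)⟩

open Classical in
/-- glue two involutions along an invariant set -/
lemma good_glue {V : Type*} (w : V → V → ℕ) (f g : V → V) (hf : GoodInv w f) (hg : GoodInv w g)
    (K : Finset V) (hKf : ∀ a, f a ∈ K ↔ a ∈ K) (hKg : ∀ a, g a ∈ K ↔ a ∈ K) :
    GoodInv w (fun a => if a ∈ K then g a else f a) := by
  constructor
  · intro a
    by_cases h : a ∈ K
    · simp [h, hKg, hg.1 a]
    · simp [h, hKf, hf.1 a]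
  · intro a
    by_cases h : a ∈ K
    · simpa [h] using hg.2 a
    · simpa [h] using hf.2 a

lemma sum_glue {V : Type*} [Fintype V] [DecidableEq V] (w : V → V → ℕ) (f g : V → V) (K : Finset V) :
    ∑ a, w a (if a ∈ K then g a else f a) + ∑ a ∈ K, w a (f a) =
      ∑ a, w a (f a) + ∑ a ∈ K, w a (g a) := by
  rw [← Finset.sum_add_sum_compl K (fun a => w a (if a ∈ K then g a else f a)),
    ← Finset.sum_add_sum_compl K (fun a => w a (f a))]
  have h1 : ∑ a ∈ K, w a (if a ∈ K then g a else f a) = ∑ a ∈ K, w a (g a) :=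
    sum_congr rfl (fun a ha => by simp [ha])
  have h2 : ∑ a ∈ Kᶜ, w a (if a ∈ K then g a else f a) = ∑ a ∈ Kᶜ, w a (f a) :=
    sum_congr rfl (fun a ha => by simp at ha; simp [ha])
  omega

open Classical in
/-- The heart of the Edmonds–Cunningham–Marsh argument. -/
lemma opt_misses_one {V : Type*} [Fintype V] (w : V → V → ℕ) (hs : ∀ a b, w a b = w b a)
    (h0 : ∀ a, w a a = 0) (C : Finset V) (a0 : V)
    (hC : ∀ a, a ∈ C ↔ Relation.ReflTransGen (fun a b => 0 < w a b) a0 a)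
    (w' d : V → V → ℕ) (hwd : ∀ a b, w a b = w' a b + d a b)
    (hd : ∀ a b, d a b = if a ∈ C ∧ 0 < w a b then 1 else 0)
    (hmiss : ∀ t, ∃ g, GoodInv w g ∧ (∀ f, GoodInv w f → ∑ v, w v (f v) ≤ ∑ v, w v (g v)) ∧ g t = t)
    (f0 : V → V) (hf0 : GoodInv w f0) :
    ∃ f, GoodInv w f ∧ ∑ v, w' v (f0 v) ≤ ∑ v, w' v (f v) ∧ C.card ≤ ∑ v, d v (f v) + 1 := by
  have hCcl : ∀ a b, 0 < w a b → a ∈ C → b ∈ C := by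
    intro a b hab ha
    rw [hC] at ha ⊢
    exact ha.tail hab
  have hgC : ∀ f, GoodInv w f → ∀ a ∈ C, f a ∈ C := by
    intro f hf a ha
    by_cases h : f a = a
    · rwa [h]
    · exact hCcl _ _ (hf.2 a h) ha
  have hdf : ∀ f, GoodInv w f → ∀ a ∈ C, d a (f a) + (if f a = a then 1 else 0) = 1 := by
    intro f hf a ha
    rw [hd]
    by_cases h : f a = a
    · simp [h, h0]
    · simp [h, ha, hf.2 a h]
  let Opt : (V → V) → Prop := fun f => GoodInv w f ∧ ∀ g, GoodInv w g →
    ∑ v, w' v (g v) ≤ ∑ v, w' v (f v) ∧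
    (∑ v, w' v (g v) = ∑ v, w' v (f v) → ∑ v, d v (g v) ≤ ∑ v, d v (f v))
  obtain ⟨f, hf⟩ : ∃ f, Opt f := by
    obtain ⟨f1, hf1, hm1⟩ := Finset.exists_max_image (univ.filter (fun f : V → V => GoodInv w f))
      (fun f => ∑ v, w' v (f v)) ⟨f0, by simp [hf0]⟩
    obtain ⟨f2, hf2, hm2⟩ := Finset.exists_max_image
      (univ.filter (fun f : V → V => GoodInv w f ∧ ∑ v, w' v (f v) = ∑ v, w' v (f1 v)))
      (fun f => ∑ v, d v (f v)) ⟨f1, by simpa using hf1⟩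
    simp only [mem_filter, mem_univ, true_and] at hf1 hm1 hf2 hm2
    refine ⟨f2, hf2.1, fun g hg => ⟨by rw [hf2.2]; exact hm1 g hg, fun h => hm2 g ⟨hg, by rw [h, hf2.2]⟩⟩⟩
  have hw'0 : ∀ a, w' a a = 0 := fun a => by have := hwd a a; rw [h0] at this; omega
  have hd0 : ∀ a, d a a = 0 := fun a => by have := hwd a a; rw [h0] at this; omega
  -- adjacent vertices are never both missed
  have hadj : ∀ u v, u ∈ C → 0 < w u v → ∀ f, Opt f → ¬ (f u = u ∧ f v = v) := by
    rintro u v hu huv f hf ⟨hfu, hfv⟩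
    have hne : u ≠ v := by rintro rfl; rw [h0] at huv; omega
    have hvC := hCcl _ _ huv hu
    have hvu : 0 < w v u := by rw [hs]; exact huv
    have hfx : ∀ a, a ≠ u → f a ≠ u := fun a ha h => ha (by rw [← hf.1.1 a, h, hfu])
    have hfy : ∀ a, a ≠ v → f a ≠ v := fun a ha h => ha (by rw [← hf.1.1 a, h, hfv])
    let h : V → V := fun a => if a = u then v else if a = v then u else f a
    have hhu : h u = v := by simp [h]
    have hhv : h v = u := by simp [h, hne.symm]
    have hho : ∀ a, a ≠ u → a ≠ v → h a = f a := fun a h1 h2 => by simp [h, h1, h2]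
    have hh : GoodInv w h := by
      constructor
      · intro a
        by_cases h1 : a = u
        · rw [h1, hhu, hhv]
        by_cases h2 : a = v
        · rw [h2, hhv, hhu]
        rw [hho a h1 h2, hho _ (hfx a h1) (hfy a h2), hf.1.1]
      · intro a hha
        by_cases h1 : a = u
        · rw [h1, hhu]; exact huv
        by_cases h2 : a = v
        · rw [h2, hhv]; exact hvu
        rw [hho a h1 h2] at hha ⊢
        exact hf.1.2 a hha
    have key : ∀ (q : V → V → ℕ), (∀ a, q a a = 0) → ∀ a, q a (f a) ≤ q a (h a) := by
      intro q hq a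
      by_cases h1 : a = u
      · rw [h1, hfu, hq]; omega
      by_cases h2 : a = v
      · rw [h2, hfv, hq]; omega
      rw [hho a h1 h2]
    have h1 : ∑ a, w' a (f a) ≤ ∑ a, w' a (h a) := sum_le_sum (fun a _ => key w' hw'0 a)
    have h2 : ∑ a, d a (f a) < ∑ a, d a (h a) := by
      apply sum_lt_sum (fun a _ => key d hd0 a)
      refine ⟨u, mem_univ _, ?_⟩
      rw [hfu, hd0, hhu, hd]
      simp [hu, huv]
    have h3 := hf.2 h hh
    have := h3.2 (le_antisymm h3.1 h1)
    omega
  have htrans : ∀ f, Opt f → ∀ u v t, t ∈ C → u ≠ v → f u = u → f v = v →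
      ∃ h, Opt h ∧ h t = t ∧ (h u = u ∨ h v = v) := by
    intro f hf u v t ht huv hfu hfv
    obtain ⟨g, hg, hgmax, hgt⟩ := hmiss t
    obtain ⟨K, htK, hKf, hKg, hKmin, hKfix⟩ := alt_component f g hf.1.1 hg.1 t
    have hKC : ∀ a ∈ K, a ∈ C := fun a ha => hKmin (C : Set V) ht
      (fun b hb => ⟨hgC f hf.1 b hb, hgC g hg b hb⟩) a ha
    have hg1 : 1 ≤ (K.filter (fun a => g a = a)).card :=
      card_pos.mpr ⟨t, by simp [htK, hgt]⟩
    have hz : ∃ z, (z = u ∨ z = v) ∧ z ∉ K := by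
      by_contra hcon
      push Not at hcon
      have hu := hcon u (Or.inl rfl)
      have hv := hcon v (Or.inr rfl)
      have : ({u, v} : Finset V) ⊆ K.filter (fun a => f a = a) := by
        intro x; simp only [mem_insert, mem_singleton, mem_filter]
        rintro (rfl | rfl)
        · exact ⟨hu, hfu⟩
        · exact ⟨hv, hfv⟩
      have := card_le_card this
      rw [card_pair huv] at this
      omega
    obtain ⟨z, hz1, hzK⟩ := hz
    have hfz : f z = z := by rcases hz1 with rfl | rfl <;> assumption
    have hcount : ∀ k, GoodInv w k → ∑ a ∈ K, d a (k a) + (K.filter (fun a => k a = a)).card = K.card := by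
      intro k hk
      rw [card_filter, ← sum_add_distrib, sum_congr rfl (fun a ha => hdf k hk a (hKC a ha))]
      simp
    have hcf := hcount f hf.1
    have hcg := hcount g hg
    have hh := good_glue w f g hf.1 hg K hKf hKg
    have hh' := good_glue w g f hg hf.1 K hKg hKf
    have s1 := sum_glue w' f g K
    have s2 := sum_glue w g f K
    have s3 := sum_glue d f g K
    have m1 := (hf.2 _ hh).1
    have m2 := hgmax _ hh'
    have sf : ∑ a ∈ K, w a (f a) = ∑ a ∈ K, w' a (f a) + ∑ a ∈ K, d a (f a) := by
      rw [← sum_add_distrib]; exact sum_congr rfl (fun a _ => hwd _ _)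
    have sg : ∑ a ∈ K, w a (g a) = ∑ a ∈ K, w' a (g a) + ∑ a ∈ K, d a (g a) := by
      rw [← sum_add_distrib]; exact sum_congr rfl (fun a _ => hwd _ _)
    refine ⟨fun a => if a ∈ K then g a else f a, ⟨hh, ?_⟩, ?_, ?_⟩
    · have e1 : ∑ a, w' a (if a ∈ K then g a else f a) = ∑ a, w' a (f a) := by omega
      have e2 : ∑ a, d a (if a ∈ K then g a else f a) = ∑ a, d a (f a) := by omega
      intro k hk
      simp only [e1, e2]
      exact hf.2 k hk
    · simp [htK, hgt]
    · rcases hz1 with rfl | rfl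
      · left; simp [hzK, hfz]
      · right; simp [hzK, hfz]
  -- any two vertices of C are never both missed
  have hR0 : ∀ u ∈ C, ∀ v, Relation.ReflTransGen (fun a b => 0 < w a b) u v → 
      v ∈ C ∧ (u = v ∨ ∀ f, Opt f → ¬ (f u = u ∧ f v = v)) := by
    intro u hu v huv
    induction huv with
    | refl => exact ⟨hu, Or.inl rfl⟩
    | tail _ hbc ih =>
      rename_i b c _
      obtain ⟨hb, ih⟩ := ih
      have hc := hCcl _ _ hbc hb
      refine ⟨hc, ?_⟩
      by_cases huc : u = c
      · exact Or.inl huc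
      right
      rintro f hf ⟨hfu, hfc⟩
      obtain ⟨h, hh, hhb, hor⟩ := htrans f hf u c b hb huc hfu hfc
      rcases hor with h1 | h1
      · rcases ih with rfl | ih
        · exact hadj _ _ hb hbc f hf ⟨hfu, hfc⟩
        · exact ih h hh ⟨h1, hhb⟩
      · exact hadj _ _ hb hbc h hh ⟨hhb, h1⟩
  have hsymm : ∀ u v, Relation.ReflTransGen (fun a b => 0 < w a b) u v →
      Relation.ReflTransGen (fun a b => 0 < w a b) v u := by
    intro u v h
    have : Std.Symm (fun a b => 0 < w a b) := ⟨fun a b h => by rw [hs]; exact h⟩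
    exact (Relation.ReflTransGen.stdSymm (r := fun a b => 0 < w a b)).symm _ _ h
  have hR : ∀ u ∈ C, ∀ v ∈ C, f u = u → f v = v → u = v := by
    intro u hu v hv hfu hfv
    have h1 := hsymm _ _ ((hC u).1 hu)
    rcases (hR0 u hu v (h1.trans ((hC v).1 hv))).2 with h | h
    · exact h
    · exact absurd ⟨hfu, hfv⟩ (h f hf)
  refine ⟨f, hf.1, (hf.2 f0 hf0).1, ?_⟩
  have c1 : (C.filter (fun a => f a = a)).card ≤ 1 := by
    rw [card_le_one]
    intro a ha b hb
    simp only [mem_filter] at ha hb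
    exact hR a ha.1 b hb.1 ha.2 hb.2
  have c2 : ∑ a ∈ C, d a (f a) + (C.filter (fun a => f a = a)).card = C.card := by
    rw [card_filter, ← sum_add_distrib, sum_congr rfl (fun a ha => hdf f hf.1 a ha)]
    simp
  have c3 : ∑ a ∈ C, d a (f a) ≤ ∑ a, d a (f a) := sum_le_univ_sum_of_nonneg (by simp)
  omega

open Classical in
lemma edmonds_core {V : Type*} [Fintype V] (x : V → V → ℝ) (xs : ∀ a b, x a b = x b a)
    (xn : ∀ a b, 0 ≤ x a b) (x1 : ∀ a, ∑ b, x a b ≤ 1)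
    (x2 : ∀ U : Finset V, Odd U.card → ∑ a ∈ U, ∑ b ∈ U, x a b ≤ (U.card : ℝ) - 1) :
    ∀ (n : ℕ) (w : V → V → ℕ), (∀ a b, w a b = w b a) → (∀ a, w a a = 0) →
      ∑ a, ∑ b, w a b ≤ n →
      ∃ f, Function.Involutive f ∧ ∑ a, ∑ b, (w a b : ℝ) * x a b ≤ ((∑ v, w v (f v) : ℕ) : ℝ) := by
  intro n
  induction n with
  | zero =>
    intro w hs h0 hn
    refine ⟨id, fun _ => rfl, ?_⟩
    have : ∀ a b, w a b = 0 := by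
      intro a b
      have h1 : ∑ a, ∑ b, w a b = 0 := by omega
      rw [sum_eq_zero_iff] at h1
      have h2 := h1 a (mem_univ _)
      rw [sum_eq_zero_iff] at h2
      exact h2 b (mem_univ _)
    simp [this]
  | succ n IH =>
    intro w hs h0 hn
    -- the general reduction
    have red : ∀ w' d : V → V → ℕ, (∀ a b, w a b = w' a b + d a b) → (∀ a b, d a b = d b a) →
        (∃ a b, 0 < d a b) → ∀ D : ℕ, ∑ a, ∑ b, (d a b : ℝ) * x a b ≤ D →
        (∀ f0, GoodInv w f0 → ∃ f, Function.Involutive f ∧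
          ∑ v, w' v (f0 v) + D ≤ ∑ v, w v (f v)) →
        ∃ f, Function.Involutive f ∧ ∑ a, ∑ b, (w a b : ℝ) * x a b ≤ ((∑ v, w v (f v) : ℕ) : ℝ) := by
      intro w' d hwd ds hpos D hD hstep
      have hs' : ∀ a b, w' a b = w' b a := by
        intro a b
        have h1 := hwd a b
        have h2 := hwd b a
        rw [hs a b, ds a b] at h1
        omega
      have h0' : ∀ a, w' a a = 0 := by
        intro a; have := hwd a a; rw [h0] at this; omega
      have hsum : ∑ a, ∑ b, w a b = ∑ a, ∑ b, w' a b + ∑ a, ∑ b, d a b := by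
        simp only [← sum_add_distrib, hwd]
      have hdpos : 0 < ∑ a, ∑ b, d a b := by
        obtain ⟨a, b, hab⟩ := hpos
        have h1 : d a b ≤ ∑ b, d a b := single_le_sum (f := fun b => d a b) (by simp) (mem_univ b)
        have h2 : ∑ b, d a b ≤ ∑ a, ∑ b, d a b :=
          single_le_sum (f := fun a => ∑ b, d a b) (by simp) (mem_univ a)
        omega
      obtain ⟨f1, hf1, hle⟩ := IH w' hs' h0' (by omega)
      obtain ⟨f0, hf0, heq⟩ := good_normalize w' hs' h0' f1 hf1
      obtain ⟨f, hf, hfle⟩ := hstep f0 (good_mono w w' (fun a b => by have := hwd a b; omega) f0 hf0)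
      refine ⟨f, hf, ?_⟩
      have e : ∑ a, ∑ b, (w a b : ℝ) * x a b =
          ∑ a, ∑ b, (w' a b : ℝ) * x a b + ∑ a, ∑ b, (d a b : ℝ) * x a b := by
        simp only [← sum_add_distrib, hwd, Nat.cast_add, add_mul]
      have hfle' : ((∑ v, w' v (f0 v) : ℕ) : ℝ) + D ≤ ((∑ v, w v (f v) : ℕ) : ℝ) := by
        exact_mod_cast hfle
      rw [← heq] at hle
      linarith
    obtain ⟨m, hm, hmax⟩ := Finset.exists_max_image (univ.filter (fun f : V → V => GoodInv w f))
      (fun f => ∑ v, w v (f v)) ⟨id, mem_filter.mpr ⟨mem_univ _, fun _ => rfl, fun v h => absurd rfl h⟩⟩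
    simp only [mem_filter, mem_univ, true_and] at hm hmax
    by_cases hcase : ∃ v, ∀ g, GoodInv w g → ∑ a, w a (g a) = ∑ a, w a (m a) → g v ≠ v
    · obtain ⟨v, hv⟩ := hcase
      let d : V → V → ℕ := fun a b => if (a = v ∨ b = v) ∧ 0 < w a b then 1 else 0
      have ds : ∀ a b, d a b = d b a := by
        intro a b
        simp only [d, hs a b, or_comm]
      have hdw : ∀ a b, d a b ≤ w a b := by
        intro a b; simp only [d]; split_ifs <;> omega
      apply red (fun a b => w a b - d a b) d (fun a b => by have := hdw a b; omega) ds ?_ 2 ?_ ?_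
      · refine ⟨v, m v, ?_⟩
        simp [d, hm.2 v (hv m hm rfl)]
      · have : ∀ a b, (d a b : ℝ) * x a b ≤ (if a = v then x a b else 0) + (if b = v then x a b else 0) := by
          intro a b
          have := xn a b
          simp only [d]
          split_ifs <;> simp <;> first | linarith | tauto
        calc _ ≤ ∑ a, ∑ b, ((if a = v then x a b else 0) + (if b = v then x a b else 0)) :=
              sum_le_sum (fun a _ => sum_le_sum (fun b _ => this a b))
          _ = ∑ b, x v b + ∑ a, x a v := by
              simp only [sum_add_distrib]
              congr 1
              · rw [sum_comm]; simp
              · simp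
          _ ≤ 1 + 1 := by
              apply add_le_add (x1 v)
              calc ∑ a, x a v = ∑ a, x v a := sum_congr rfl (fun a _ => xs _ _)
                _ ≤ 1 := x1 v
          _ = _ := by norm_num
      · intro f0 hf0
        refine ⟨m, hm.1, ?_⟩
        have hle := hmax f0 hf0
        have hsplit : ∑ a, w a (f0 a) = ∑ a, (w a (f0 a) - d a (f0 a)) + ∑ a, d a (f0 a) := by
          rw [← sum_add_distrib]
          exact sum_congr rfl (fun a _ => by have := hdw a (f0 a); omega)
        by_cases hfv : f0 v = v
        · have hne : ∑ a, w a (f0 a) ≠ ∑ a, w a (m a) := fun h => hv f0 hf0 h hfv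
          obtain ⟨p, hp⟩ := even_weight f0 hf0.1 w hs h0
          obtain ⟨q, hq⟩ := even_weight m hm.1 w hs h0
          omega
        · have h2 : 2 ≤ ∑ a, d a (f0 a) := by
            have hsub : ∑ a ∈ ({v, f0 v} : Finset V), d a (f0 a) ≤ ∑ a, d a (f0 a) :=
              sum_le_univ_sum_of_nonneg (by simp)
            rw [sum_pair (fun h => hfv h.symm)] at hsub
            have p1 := hf0.2 v hfv
            have e1 : d v (f0 v) = 1 := by simp [d, p1]
            rw [hf0.1 v, ds (f0 v) v, e1] at hsub
            omega
          omega
    · push Not at hcase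
      by_cases hw : ∀ a b, w a b = 0
      · exact ⟨id, fun _ => rfl, by simp [hw]⟩
      push Not at hw
      obtain ⟨a0, b0, hab⟩ := hw
      let C : Finset V := univ.filter (fun a => Relation.ReflTransGen (fun a b => 0 < w a b) a0 a)
      have hC : ∀ a, a ∈ C ↔ Relation.ReflTransGen (fun a b => 0 < w a b) a0 a := by
        intro a; simp [C]
      have hCcl : ∀ a b, 0 < w a b → a ∈ C → b ∈ C := by
        intro a b hab ha
        rw [hC] at ha ⊢
        exact ha.tail hab
      let d : V → V → ℕ := fun a b => if a ∈ C ∧ 0 < w a b then 1 else 0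
      have ds : ∀ a b, d a b = d b a := by
        intro a b
        have h1 := hCcl a b
        have h2 := hCcl b a
        simp only [d, hs b a] at h1 h2 ⊢
        congr 1
        apply propext
        tauto
      have hd0 : ∀ a, d a a = 0 := by intro a; simp [d, h0]
      have hdw : ∀ a b, d a b ≤ w a b := by
        intro a b; simp only [d]; split_ifs <;> omega
      have hdC : ∑ a, ∑ b, (d a b : ℝ) * x a b ≤ ∑ a ∈ C, ∑ b ∈ C, x a b := by
        have e : ∑ a ∈ C, ∑ b ∈ C, x a b =
            ∑ a, ∑ b, (if a ∈ C then (if b ∈ C then x a b else 0) else 0) := by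
          rw [← sum_subset (subset_univ C) (fun a _ ha => by simp [ha])]
          refine sum_congr rfl (fun a ha => ?_)
          rw [← sum_subset (subset_univ C) (fun b _ hb => by simp [hb])]
          exact sum_congr rfl (fun b hb => by simp [ha, hb])
        rw [e]
        refine sum_le_sum (fun a _ => sum_le_sum (fun b _ => ?_))
        have := xn a b
        by_cases h : a ∈ C ∧ 0 < w a b
        · simp [d, h, hCcl a b h.2 h.1]
        · simp only [d, h, if_false]
          split_ifs <;> simp [this]
      have hD : ∑ a, ∑ b, (d a b : ℝ) * x a b ≤ ((2 * (C.card / 2) : ℕ) : ℝ) := by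
        refine hdC.trans ?_
        rcases Nat.even_or_odd C.card with he | ho
        · have : 2 * (C.card / 2) = C.card := Nat.two_mul_div_two_of_even he
          rw [this]
          calc ∑ a ∈ C, ∑ b ∈ C, x a b ≤ ∑ a ∈ C, (1 : ℝ) := by
                apply sum_le_sum
                intro a _
                refine le_trans ?_ (x1 a)
                exact sum_le_univ_sum_of_nonneg (xn a)
            _ = C.card := by simp
        · have : 2 * (C.card / 2) + 1 = C.card := Nat.two_mul_div_two_add_one_of_odd ho
          have h3 : ((2 * (C.card / 2) : ℕ) : ℝ) + 1 = C.card := by exact_mod_cast this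
          have := x2 C ho
          linarith
      have hwd : ∀ a b, w a b = (w a b - d a b) + d a b := fun a b => by have := hdw a b; omega
      apply red (fun a b => w a b - d a b) d hwd ds ?_ _ hD ?_
      · refine ⟨a0, b0, ?_⟩
        have : a0 ∈ C := by rw [hC]
        simp [d, this, Nat.pos_of_ne_zero hab]
      · intro f0 hf0
        obtain ⟨f, hf, hle, hcard⟩ := opt_misses_one w hs h0 C a0 hC (fun a b => w a b - d a b) d hwd
          (fun a b => rfl) (fun t => by
            obtain ⟨g, hg, hge, hgt⟩ := hcase t
            exact ⟨g, hg, fun f hf => by rw [hge]; exact hmax f hf, hgt⟩) f0 hf0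
        refine ⟨f, hf.1, ?_⟩
        have hsplit : ∑ a, w a (f a) = ∑ a, (w a (f a) - d a (f a)) + ∑ a, d a (f a) := by
          rw [← sum_add_distrib]
          exact sum_congr rfl (fun a _ => by have := hdw a (f a); omega)
        obtain ⟨p, hp⟩ := even_weight f hf.1 d ds hd0
        omega

open Classical in
/-- The symmetric matrix attached to a vector indexed by edges. -/
def edgeMat {V : Type*} (G : SimpleGraph V) (z : G.edgeSet → ℝ) (u v : V) : ℝ :=
  if h : G.Adj u v then z ⟨s(u, v), h⟩ else 0

lemma edgeMat_adj {V : Type*} {G : SimpleGraph V} (z : G.edgeSet → ℝ) {u v : V} (h : G.Adj u v) :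
    edgeMat G z u v = z ⟨s(u, v), h⟩ := by simp [edgeMat, h]

lemma edgeMat_not {V : Type*} {G : SimpleGraph V} (z : G.edgeSet → ℝ) {u v : V} (h : ¬ G.Adj u v) :
    edgeMat G z u v = 0 := by simp [edgeMat, h]

lemma edgeMat_self {V : Type*} {G : SimpleGraph V} (z : G.edgeSet → ℝ) (u : V) :
    edgeMat G z u u = 0 := edgeMat_not z (G.irrefl)

lemma edgeMat_symm {V : Type*} {G : SimpleGraph V} (z : G.edgeSet → ℝ) (u v : V) :
    edgeMat G z u v = edgeMat G z v u := by
  by_cases h : G.Adj u v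
  · rw [edgeMat_adj z h, edgeMat_adj z h.symm]
    congr 1
    exact Subtype.ext Sym2.eq_swap
  · rw [edgeMat_not z h, edgeMat_not z (fun h' => h h'.symm)]

lemma edgeMat_add {V : Type*} {G : SimpleGraph V} (y z : G.edgeSet → ℝ) (u v : V) :
    edgeMat G (y + z) u v = edgeMat G y u v + edgeMat G z u v := by
  unfold edgeMat; split_ifs <;> simp

lemma edgeMat_smul {V : Type*} {G : SimpleGraph V} (c : ℝ) (z : G.edgeSet → ℝ) (u v : V) :
    edgeMat G (c • z) u v = c * edgeMat G z u v := by
  unfold edgeMat; split_ifs <;> simp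

lemma edgeMat_mul {V : Type*} {G : SimpleGraph V} (y z : G.edgeSet → ℝ) (u v : V) :
    edgeMat G (fun e => y e * z e) u v = edgeMat G y u v * edgeMat G z u v := by
  unfold edgeMat; split_ifs <;> simp

lemma edgeMat_continuous {V : Type*} (G : SimpleGraph V) (u v : V) :
    Continuous (fun z => edgeMat G z u v) := by
  unfold edgeMat
  split_ifs <;> fun_prop

open Classical in
lemma edgeMat_sum {V : Type*} [Fintype V] (G : SimpleGraph V) (z : G.edgeSet → ℝ) :
    ∑ u, ∑ v, edgeMat G z u v = 2 * ∑ e, z e := by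
  have h1 : ∑ u, ∑ v, edgeMat G z u v = ∑ u, ∑ v, ∑ e : G.edgeSet, (if s(u, v) = (e : Sym2 V) then z e else 0) := by
    refine sum_congr rfl (fun u _ => sum_congr rfl (fun v _ => ?_))
    by_cases h : G.Adj u v
    · rw [edgeMat_adj z h, sum_eq_single ⟨s(u, v), h⟩]
      · simp
      · intro e _ he
        rw [if_neg]
        intro h'; exact he (Subtype.ext h'.symm)
      · simp
    · rw [edgeMat_not z h]
      symm
      apply sum_eq_zero
      intro e _
      rw [if_neg]
      intro h'
      apply h
      have := e.2
      rw [← h'] at this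
      exact this
  rw [h1]
  have h2 : ∀ e : G.edgeSet, ∑ u, ∑ v, (if s(u, v) = (e : Sym2 V) then z e else 0) = 2 * z e := by
    rintro ⟨e, he⟩
    induction e using Sym2.ind with
    | _ a b =>
    have hne : a ≠ b := G.ne_of_adj he
    have : ∀ u v, (if s(u, v) = s(a, b) then z ⟨s(a, b), he⟩ else 0) =
      (if u = a then (if v = b then z ⟨s(a, b), he⟩ else 0) else 0) +
      (if u = b then (if v = a then z ⟨s(a, b), he⟩ else 0) else 0) := by
      intro u v
      simp only [Sym2.eq_iff]
      split_ifs <;> simp_all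
    simp only [this, sum_add_distrib]
    simp [two_mul]
  calc _ = ∑ u, ∑ e : G.edgeSet, ∑ v, (if s(u, v) = (e : Sym2 V) then z e else 0) :=
        sum_congr rfl (fun u _ => sum_comm)
    _ = ∑ e : G.edgeSet, ∑ u, ∑ v, (if s(u, v) = (e : Sym2 V) then z e else 0) := sum_comm
    _ = _ := by simp only [h2, mul_sum]

open Classical in
/-- The theorem of Edmonds (the hard direction). -/
lemma edmonds {V : Type*} [Fintype V] (G : SimpleGraph V) (y : G.edgeSet → ℝ)
    (yn : ∀ e, 0 ≤ y e) (y1 : ∀ a, ∑ b, edgeMat G y a b ≤ 1)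
    (y2 : ∀ U : Finset V, Odd U.card → ∑ a ∈ U, ∑ b ∈ U, edgeMat G y a b ≤ (U.card : ℝ) - 1) :
    y ∈ matchingPolytope G := by
  by_contra hy
  have hfin : {x : G.edgeSet → ℝ | ∃ M : Set (Sym2 V), M ⊆ G.edgeSet ∧
    (∀ e ∈ M, ∀ f ∈ M, e ≠ f → ∀ v : V, ¬(v ∈ e ∧ v ∈ f)) ∧
    x = Set.indicator {e : G.edgeSet | (e : Sym2 V) ∈ M} (fun _ => (1 : ℝ))}.Finite := by
    apply (Set.finite_range (fun M : Set (Sym2 V) =>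
      Set.indicator {e : G.edgeSet | (e : Sym2 V) ∈ M} (fun _ => (1 : ℝ)))).subset
    rintro x ⟨M, _, _, rfl⟩
    exact ⟨M, rfl⟩
  have hclosed : IsClosed (matchingPolytope G) := (hfin.isCompact_convexHull ℝ).isClosed
  obtain ⟨F, r, hF, hFy⟩ := geometric_hahn_banach_closed_point (convex_convexHull ℝ _) hclosed hy
  let c : G.edgeSet → ℝ := fun e => F (Pi.single e 1)
  have hFc : ∀ z, F z = ∑ e, c e * z e := by
    intro z
    have := LinearMap.pi_apply_eq_sum_univ (F : (G.edgeSet → ℝ) →ₗ[ℝ] ℝ) z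
    simp only [ContinuousLinearMap.coe_coe, smul_eq_mul] at this
    rw [this]
    refine sum_congr rfl (fun e _ => ?_)
    rw [mul_comm]
    congr 2
    ext j
    simp [Pi.single_apply, eq_comm]
  have yn' : ∀ a b, 0 ≤ edgeMat G y a b := by
    intro a b; unfold edgeMat; split_ifs
    · exact yn _
    · exact le_rfl
  obtain ⟨N, hN⟩ := exists_nat_gt ((Fintype.card V : ℝ) / (2 * (F y - r)))
  have hpos : 0 < 2 * (F y - r) := by linarith
  rw [div_lt_iff₀ hpos] at hN
  let w : V → V → ℕ := fun a b => ⌈(N : ℝ) * edgeMat G c a b⌉₊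
  have ws : ∀ a b, w a b = w b a := fun a b => by simp only [w, edgeMat_symm c a b]
  have w0 : ∀ a, w a a = 0 := fun a => by simp only [w, edgeMat_self]; simp
  obtain ⟨f1, hf1, hle1⟩ := edmonds_core (edgeMat G y) (edgeMat_symm y) yn' y1 y2 _ w ws w0 le_rfl
  obtain ⟨f, hf, heq⟩ := good_normalize w ws w0 f1 hf1
  rw [← heq] at hle1
  have hadj : ∀ v, f v ≠ v → G.Adj v (f v) := by
    intro v hv
    by_contra h
    have := hf.2 v hv
    simp [w, edgeMat_not c h] at this
  let M : Set (Sym2 V) := {e | ∃ v, f v ≠ v ∧ e = s(v, f v)}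
  have hMmem : ∀ a b, a ≠ b → (s(a, b) ∈ M ↔ b = f a) := by
    intro a b hab
    constructor
    · rintro ⟨v, hv, h⟩
      rw [Sym2.eq_iff] at h
      rcases h with ⟨rfl, rfl⟩ | ⟨rfl, rfl⟩
      · rfl
      · rw [hf.1]
    · rintro rfl
      exact ⟨a, fun h => hab h.symm, rfl⟩
  let p : G.edgeSet → ℝ := Set.indicator {e : G.edgeSet | (e : Sym2 V) ∈ M} (fun _ => (1 : ℝ))
  have hp : p ∈ matchingPolytope G := by
    apply subset_convexHull
    refine ⟨M, ?_, ?_, rfl⟩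
    · rintro e ⟨v, hv, rfl⟩
      exact hadj v hv
    · rintro e ⟨a, ha, rfl⟩ e' ⟨b, hb, rfl⟩ hne v ⟨h1, h2⟩
      apply hne
      have key : ∀ a, v ∈ s(a, f a) → s(a, f a) = s(v, f v) := by
        intro a h
        rw [Sym2.mem_iff] at h
        rcases h with rfl | rfl
        · rfl
        · rw [hf.1, Sym2.eq_swap]
      rw [key a h1, key b h2]
  have hFp : 2 * F p = ∑ v, edgeMat G c v (f v) := by
    rw [hFc, ← edgeMat_sum]
    refine sum_congr rfl (fun u _ => ?_)
    simp only [edgeMat_mul]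
    have : ∀ v, edgeMat G c u v * edgeMat G p u v = if v = f u then edgeMat G c u v else 0 := by
      intro v
      by_cases h : G.Adj u v
      · rw [edgeMat_adj p h]
        by_cases h' : v = f u
        · have : s(u, v) ∈ M := (hMmem u v h.ne).2 h'
          have hp1 : p ⟨s(u, v), h⟩ = 1 := Set.indicator_of_mem (show (⟨s(u, v), h⟩ : G.edgeSet) ∈ {e : G.edgeSet | (e : Sym2 V) ∈ M} from this) _
          rw [hp1, if_pos h', mul_one]
        · have : s(u, v) ∉ M := fun hh => h' ((hMmem u v h.ne).1 hh)
          simp [p, Set.indicator, this, h']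
      · simp [edgeMat_not c h]
    simp [this]
  have hFy2 : 2 * F y = ∑ a, ∑ b, edgeMat G c a b * edgeMat G y a b := by
    rw [hFc, ← edgeMat_sum]
    simp only [edgeMat_mul]
  have hup : ((∑ v, w v (f v) : ℕ) : ℝ) ≤ N * (2 * F p) + Fintype.card V := by
    rw [hFp, mul_sum, Nat.cast_sum]
    have : (Fintype.card V : ℝ) = ∑ v : V, (1 : ℝ) := by simp
    rw [this, ← sum_add_distrib]
    refine sum_le_sum (fun v _ => ?_)
    by_cases h : f v = v
    · rw [h, w0, edgeMat_self]; simp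
    · have h1 := hf.2 v h
      simp only [w] at h1 ⊢
      rw [Nat.ceil_pos] at h1
      exact (Nat.ceil_lt_add_one h1.le).le
  have hlow : N * (2 * F y) ≤ ∑ a, ∑ b, (w a b : ℝ) * edgeMat G y a b := by
    rw [hFy2, mul_sum]
    refine sum_le_sum (fun a _ => ?_)
    rw [mul_sum]
    refine sum_le_sum (fun b _ => ?_)
    rw [← mul_assoc]
    exact mul_le_mul_of_nonneg_right (Nat.le_ceil _) (yn' a b)
  have h1 := hF p hp
  have h2 : (N : ℝ) * (2 * F p) ≤ N * (2 * r) := by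
    apply mul_le_mul_of_nonneg_left _ (Nat.cast_nonneg N); linarith
  nlinarith

open Classical in
lemma polytope_bounds {V : Type*} [Fintype V] (G : SimpleGraph V) :
    matchingPolytope G ⊆ {z | (∀ e, 0 ≤ z e) ∧ ∀ v, ∑ u, edgeMat G z v u ≤ 1} := by
  apply convexHull_min
  · rintro z ⟨M, hM, hdis, rfl⟩
    refine ⟨fun e => Set.indicator_nonneg (by simp) _, fun v => ?_⟩
    have hval : ∀ u, edgeMat G (Set.indicator {e : G.edgeSet | (e : Sym2 V) ∈ M} (fun _ => (1 : ℝ))) v u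
        = if s(v, u) ∈ M then 1 else 0 := by
      intro u
      by_cases h : G.Adj v u
      · rw [edgeMat_adj _ h]; simp [Set.indicator]
      · rw [edgeMat_not _ h, if_neg (fun h' => h (hM h'))]
    simp only [hval, sum_boole]
    norm_cast
    rw [card_le_one]
    intro a ha b hb
    simp only [mem_filter, mem_univ, true_and] at ha hb
    by_contra hab
    exact hdis _ ha _ hb (fun h => hab (Sym2.congr_right.mp h)) v (by simp)
  · intro y hy z hz a b ha hb hab
    refine ⟨fun e => ?_, fun v => ?_⟩
    · have := hy.1 e; have := hz.1 e
      simp only [Pi.add_apply, Pi.smul_apply, smul_eq_mul]; positivity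
    · simp only [edgeMat_add, edgeMat_smul, sum_add_distrib, ← mul_sum]
      have := hy.2 v; have := hz.2 v
      nlinarith

lemma edgeMat_one_sum {V : Type*} [Fintype V] (G : SimpleGraph V) [DecidableRel G.Adj] (v : V) :
    ∑ u, edgeMat G (fun _ => 1) v u = G.degree v := by
  classical
  have : ∀ u, edgeMat G (fun _ => 1) v u = if G.Adj v u then 1 else 0 := by
    intro u; unfold edgeMat; split_ifs <;> rfl
  simp only [this, sum_boole]
  rw [← SimpleGraph.card_neighborFinset_eq_degree, SimpleGraph.neighborFinset_eq_filter]

lemma lower_bound {V : Type*} [Fintype V] (G : SimpleGraph V) [DecidableRel G.Adj] (k : ℕ)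
    (hk : 0 < k) (x : G.edgeSet → ℝ) (hx : IsLatticePt x)
    (hint : x ∈ interior (dilate k (matchingPolytope G))) : G.maxDegree + 1 ≤ k := by
  classical
  by_cases hΔ : G.maxDegree = 0
  · omega
  have hkpos : (0 : ℝ) < k := by exact_mod_cast hk
  have hb : ∀ z ∈ dilate k (matchingPolytope G), (∀ e, 0 ≤ z e) ∧ ∀ v, ∑ u, edgeMat G z v u ≤ k := by
    rintro z ⟨y, hy, rfl⟩
    obtain ⟨h1, h2⟩ := polytope_bounds G hy
    refine ⟨fun e => ?_, fun v => ?_⟩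
    · have := h1 e
      simp only [Pi.smul_apply, smul_eq_mul]; positivity
    · simp only [edgeMat_smul, ← mul_sum]
      have := h2 v
      nlinarith
  have hne : Nonempty V := by
    by_contra h
    rw [not_nonempty_iff] at h
    exact hΔ (by simp [SimpleGraph.maxDegree, Finset.univ_eq_empty])
  obtain ⟨v, hv⟩ := G.exists_maximal_degree_vertex
  let γ : ℝ → (G.edgeSet → ℝ) := fun ε => x + ε • (fun _ => (1 : ℝ))
  have hγ : Continuous γ := by fun_prop
  have hγ0 : γ 0 = x := by simp [γ]
  have hnhds : γ ⁻¹' (interior (dilate k (matchingPolytope G))) ∈ nhds (0 : ℝ) :=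
    (isOpen_interior.preimage hγ).mem_nhds (by simpa [hγ0] using hint)
  obtain ⟨ε, hε, hball⟩ := Metric.mem_nhds_iff.mp hnhds
  have hmem : ∀ δ : ℝ, |δ| < ε → γ δ ∈ dilate k (matchingPolytope G) := fun δ hδ =>
    interior_subset (hball (by simpa using hδ))
  have hp := hb _ (hmem (ε / 2) (by rw [abs_of_pos (by linarith)]; linarith))
  have hm := hb _ (hmem (-(ε / 2)) (by rw [abs_neg, abs_of_pos (by linarith)]; linarith))
  have hx1 : ∀ e, 1 ≤ x e := by
    intro e
    have h1 := hm.1 e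
    obtain ⟨n, hn⟩ := hx e
    simp only [γ, Pi.add_apply, Pi.smul_apply, smul_eq_mul, mul_one] at h1
    have : (0 : ℝ) < n := by rw [← hn]; linarith
    rw [hn]
    exact_mod_cast this
  have h2 := hp.2 v
  simp only [γ, edgeMat_add, edgeMat_smul, sum_add_distrib, ← mul_sum, edgeMat_one_sum] at h2
  have h3 : ∑ u, edgeMat G (fun _ => 1) v u ≤ ∑ u, edgeMat G x v u := by
    refine sum_le_sum (fun u _ => ?_)
    unfold edgeMat
    split_ifs
    · exact hx1 _
    · exact le_rfl
  rw [edgeMat_one_sum] at h3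
  rw [← hv] at h2 h3
  have h4 : (0 : ℝ) < G.maxDegree := by exact_mod_cast Nat.pos_of_ne_zero hΔ
  have h5 : (G.maxDegree : ℝ) < k := by nlinarith
  exact_mod_cast h5

open Classical in
/-- strict odd-set inequality for the all-ones vector -/
lemma odd_strict {V : Type*} [Fintype V] (G : SimpleGraph V) [DecidableRel G.Adj]
    (hconn : G.Connected) (h : ¬ (G = ⊤ ∧ Odd (Fintype.card V))) (U : Finset V)
    (hU : Odd U.card) (hU1 : 1 < U.card) :
    ∑ a ∈ U, (U.filter (fun b => G.Adj a b)).card < (G.maxDegree + 1) * (U.card - 1) := by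
  have hsub : ∀ a ∈ U, U.filter (fun b => G.Adj a b) ⊆ U.erase a := by
    intro a ha b hb
    simp only [mem_filter] at hb
    exact mem_erase.mpr ⟨hb.2.ne', hb.1⟩
  have b1 : ∀ a ∈ U, (U.filter (fun b => G.Adj a b)).card ≤ U.card - 1 := by
    intro a ha
    rw [← card_erase_of_mem ha]
    exact card_le_card (hsub a ha)
  have b2 : ∀ a ∈ U, (U.filter (fun b => G.Adj a b)).card ≤ G.maxDegree := by
    intro a ha
    refine le_trans ?_ (G.degree_le_maxDegree a)
    rw [← SimpleGraph.card_neighborFinset_eq_degree]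
    apply card_le_card
    intro b hb
    simp only [mem_filter] at hb
    simpa using hb.2
  have s1 := sum_le_sum b1
  have s2 := sum_le_sum b2
  simp only [sum_const, smul_eq_mul] at s1 s2
  obtain ⟨s, hs⟩ : ∃ s, U.card = s + 1 := ⟨U.card - 1, by omega⟩
  rw [hs] at s1 s2 b1 hU1 ⊢
  simp only [Nat.add_sub_cancel] at s1 b1 ⊢
  rcases lt_trichotomy G.maxDegree s with hlt | heq | hgt
  · nlinarith
  · rw [heq]
    refine lt_of_le_of_ne s1 (fun he => ?_)
    have hall : ∀ a ∈ U, (U.filter (fun b => G.Adj a b)).card = s := by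
      have : ∑ a ∈ U, (U.filter (fun b => G.Adj a b)).card = ∑ a ∈ U, s := by
        rw [he]; simp [hs]
      exact (sum_eq_sum_iff_of_le b1).1 this
    have hclique : ∀ a ∈ U, U.filter (fun b => G.Adj a b) = U.erase a := by
      intro a ha
      apply eq_of_subset_of_card_le (hsub a ha)
      rw [card_erase_of_mem ha, hall a ha]; omega
    have hclosed : ∀ a ∈ U, ∀ b, G.Adj a b → b ∈ U := by
      intro a ha b hab
      have hsubn : U.filter (fun b => G.Adj a b) ⊆ G.neighborFinset a := by
        intro b hb
        simp only [mem_filter] at hb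
        simpa using hb.2
      have : U.filter (fun b => G.Adj a b) = G.neighborFinset a := by
        apply eq_of_subset_of_card_le hsubn
        rw [hall a ha, ← heq, SimpleGraph.card_neighborFinset_eq_degree]
        exact G.degree_le_maxDegree a
      have hb : b ∈ G.neighborFinset a := by simpa using hab
      rw [← this] at hb
      exact (mem_filter.mp hb).1
    obtain ⟨a, ha⟩ : U.Nonempty := card_pos.mp (by omega)
    have huniv : ∀ b, b ∈ U := by
      intro b
      obtain ⟨p⟩ := hconn.preconnected a b
      induction p with
      | nil => exact ha
      | cons hab _ ih => exact ih (hclosed _ ha _ hab)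
    have hUu : U = univ := by ext b; simp [huniv b]
    apply h
    constructor
    · ext a b
      simp only [SimpleGraph.top_adj]
      refine ⟨fun h => h.ne, fun hne => ?_⟩
      have : b ∈ U.erase a := mem_erase.mpr ⟨hne.symm, huniv b⟩
      rw [← hclique a (huniv a)] at this
      exact (mem_filter.mp this).2
    · rw [hUu] at hU
      simpa using hU
  · nlinarith

lemma upper_bound {V : Type*} [Fintype V] (G : SimpleGraph V) [DecidableRel G.Adj]
    (hconn : G.Connected) (h : ¬ (G = ⊤ ∧ Odd (Fintype.card V))) :
    (fun _ => (1 : ℝ)) ∈ interior (dilate (G.maxDegree + 1) (matchingPolytope G)) := by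
  classical
  rw [mem_interior]
  set n : ℝ := ((G.maxDegree + 1 : ℕ) : ℝ) with hn
  have hnpos : 0 < n := by rw [hn]; positivity
  let S : Set (G.edgeSet → ℝ) := {z | (∀ e, 0 < z e) ∧ (∀ v, ∑ u, edgeMat G z v u < n) ∧
    ∀ U : {U : Finset V // Odd U.card ∧ 1 < U.card},
      ∑ a ∈ U.1, ∑ b ∈ U.1, edgeMat G z a b < n * ((U.1.card : ℝ) - 1)}
  refine ⟨S, ?_, ?_, ?_⟩
  · rintro z ⟨z0, z1, z2⟩
    refine ⟨n⁻¹ • z, ?_, ?_⟩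
    · apply edmonds
      · intro e
        have := z0 e
        simp only [Pi.smul_apply, smul_eq_mul]; positivity
      · intro v
        simp only [edgeMat_smul, ← mul_sum]
        rw [inv_mul_le_iff₀ hnpos]
        linarith [z1 v]
      · intro U hU
        simp only [edgeMat_smul, ← mul_sum]
        rw [inv_mul_le_iff₀ hnpos]
        by_cases hU1 : 1 < U.card
        · exact (z2 ⟨U, hU, hU1⟩).le
        · have hc : U.card = 1 := by
            have := hU.pos; omega
          obtain ⟨a, rfl⟩ := card_eq_one.mp hc
          simp [edgeMat_self]
    · simp only [← hn]
      rw [smul_smul, mul_inv_cancel₀ hnpos.ne', one_smul]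
  · have e : S = (⋂ e, {z | 0 < z e}) ∩ ((⋂ v, {z | ∑ u, edgeMat G z v u < n}) ∩
      ⋂ U : {U : Finset V // Odd U.card ∧ 1 < U.card},
        {z | ∑ a ∈ U.1, ∑ b ∈ U.1, edgeMat G z a b < n * ((U.1.card : ℝ) - 1)}) := by
      ext z; simp only [S, Set.mem_setOf_eq, Set.mem_inter_iff, Set.mem_iInter]
    rw [e]
    refine IsOpen.inter (isOpen_iInter_of_finite fun e => ?_)
      (IsOpen.inter (isOpen_iInter_of_finite fun v => ?_) (isOpen_iInter_of_finite fun U => ?_))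
    · exact isOpen_lt continuous_const (continuous_apply e)
    · exact isOpen_lt (continuous_finset_sum _ fun u _ => edgeMat_continuous G v u) continuous_const
    · exact isOpen_lt (continuous_finset_sum _ fun a _ => continuous_finset_sum _ fun b _ =>
        edgeMat_continuous G a b) continuous_const
  · refine ⟨fun e => one_pos, fun v => ?_, ?_⟩
    · rw [edgeMat_one_sum, hn]
      exact_mod_cast Nat.lt_succ_of_le (G.degree_le_maxDegree v)
    · rintro ⟨U, hU, hU1⟩
      have hval : ∀ a u, edgeMat G (fun _ => 1) a u = if G.Adj a u then 1 else 0 := by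
        intro a u; unfold edgeMat; split_ifs <;> rfl
      simp only [hval, sum_boole]
      have := odd_strict G hconn h U hU hU1
      have h1 : ((U.card - 1 : ℕ) : ℝ) = (U.card : ℝ) - 1 := by
        rw [Nat.cast_sub hU1.le]; simp
      rw [hn, ← h1]
      exact_mod_cast this

/-- A connected graph `G` that is not a complete graph of odd order has
`codeg(M_G) = Δ(G) + 1`. -/
theorem stmt8 {V : Type*} [Fintype V] (G : SimpleGraph V) [DecidableRel G.Adj]
    (hconn : G.Connected) (h : ¬ (G = ⊤ ∧ Odd (Fintype.card V))) :
    codeg (matchingPolytope G) = G.maxDegree + 1 := by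
  apply IsLeast.csInf_eq
  constructor
  · exact ⟨Nat.succ_pos _, _, fun _ => ⟨1, by simp⟩, upper_bound G hconn h⟩
  · rintro k ⟨hk, x, hx, hint⟩
    exact lower_bound G k hk x hx hint
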